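/- Let w and v be classical solutions of the full damped inextensible cantilever system with the same smooth forcing p. If w(x,0) = v(x,0) and w_t(x,0) = v_t(x,0) for all x ∈ [0,L], then w(x,t) = v(x,t) for all (x,t) ∈ [0,L]×[0,T]. -/

import Mathlib

open MeasureTheory Set

/-- Spatial partial derivative of a function of `(x, t)`. -/
noncomputable def pdx (f : ℝ → ℝ → ℝ) : ℝ → ℝ → ℝ := fun x t => deriv (fun y => f y t) x

/-- Temporal partial derivative of a function of `(x, t)`. -/
noncomputable def pdt (f : ℝ → ℝ → ℝ) : ℝ → ℝ → ℝ := fun x t => deriv (fun s => f x s) t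

/-- Axial displacement from the effective inextensibility constraint:
`u(x,t) = -(1/2)∫₀ˣ w_x(ξ,t)² dξ`. -/
noncomputable def uF (w : ℝ → ℝ → ℝ) : ℝ → ℝ → ℝ := fun x t =>
  -(1/2) * ∫ ξ in (0:ℝ)..x, (pdx w ξ t) ^ 2

/-- `u_t(x,t) = -∫₀ˣ w_x w_xt dξ`. -/
noncomputable def utF (w : ℝ → ℝ → ℝ) : ℝ → ℝ → ℝ := fun x t =>
  -∫ ξ in (0:ℝ)..x, pdx w ξ t * pdt (pdx w) ξ t

/-- `u_tt(x,t) = -∫₀ˣ [w_xt² + w_x w_xtt] dξ`. -/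
noncomputable def uttF (w : ℝ → ℝ → ℝ) : ℝ → ℝ → ℝ := fun x t =>
  -∫ ξ in (0:ℝ)..x, ((pdt (pdx w) ξ t) ^ 2 + pdx w ξ t * pdt (pdt (pdx w)) ξ t)

/-- A classical solution of the full damped inextensible cantilever system on
`[0,L] × [0,T]` with forcing `p`: smooth on an open neighborhood of `[0,L] × [0,T]`,
satisfying the PDE
`w_tt + D ∂ₓ⁴w + k₂ ∂ₓ⁴w_t − D ∂ₓ(w_xx² w_x) + D ∂ₓ²(w_x² w_xx) + ∂ₓ(w_x ∫ₓᴸ u_tt dξ) = p`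
pointwise and the clamped-free boundary conditions. -/
def IsFullSol (L D k2 T : ℝ) (p w : ℝ → ℝ → ℝ) : Prop :=
  (∃ U : Set (ℝ × ℝ), IsOpen U ∧ Icc (0:ℝ) L ×ˢ Icc (0:ℝ) T ⊆ U ∧
      ContDiffOn ℝ (⊤ : ℕ∞) (fun q : ℝ × ℝ => w q.1 q.2) U) ∧
  (∀ x ∈ Icc (0:ℝ) L, ∀ t ∈ Icc (0:ℝ) T,
      pdt (pdt w) x t + D * pdx (pdx (pdx (pdx w))) x t
        + k2 * pdx (pdx (pdx (pdx (pdt w)))) x t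
        - D * pdx (fun y s => (pdx (pdx w) y s) ^ 2 * pdx w y s) x t
        + D * pdx (pdx (fun y s => (pdx w y s) ^ 2 * pdx (pdx w) y s)) x t
        + pdx (fun y s => pdx w y s * ∫ ξ in y..L, uttF w ξ s) x t
      = p x t) ∧
  (∀ t ∈ Icc (0:ℝ) T,
    w 0 t = 0 ∧ pdx w 0 t = 0 ∧ pdx (pdx w) L t = 0 ∧ pdx (pdx (pdx w)) L t = 0)

/-- Globally smooth functions of two variables. -/
def Sm (f : ℝ → ℝ → ℝ) : Prop := ContDiff ℝ (⊤ : ℕ∞) (fun q : ℝ × ℝ => f q.1 q.2)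

lemma Sm.cont {f : ℝ → ℝ → ℝ} (h : Sm f) : Continuous (fun q : ℝ × ℝ => f q.1 q.2) :=
  ContDiff.continuous h

lemma Sm.contx {f : ℝ → ℝ → ℝ} (h : Sm f) (t : ℝ) : Continuous (fun x => f x t) :=
  h.cont.comp (by fun_prop : Continuous fun x : ℝ => (x, t))

lemma Sm.pdx_eq {f : ℝ → ℝ → ℝ} (h : Sm f) (x t : ℝ) :
    HasDerivAt (fun y => f y t) (fderiv ℝ (fun q : ℝ × ℝ => f q.1 q.2) (x, t) (1, 0)) x := by
  have h1 : HasFDerivAt (fun q : ℝ × ℝ => f q.1 q.2) _ (x, t) :=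
    ((ContDiff.differentiable h (by simp)) (x, t)).hasFDerivAt
  have h2 : HasDerivAt (fun y : ℝ => (y, t)) ((1 : ℝ), (0 : ℝ)) x :=
    (hasDerivAt_id x).prodMk (hasDerivAt_const x t)
  exact h1.comp_hasDerivAt x h2

lemma Sm.pdt_eq {f : ℝ → ℝ → ℝ} (h : Sm f) (x t : ℝ) :
    HasDerivAt (fun s => f x s) (fderiv ℝ (fun q : ℝ × ℝ => f q.1 q.2) (x, t) (0, 1)) t := by
  have h1 : HasFDerivAt (fun q : ℝ × ℝ => f q.1 q.2) _ (x, t) :=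
    ((ContDiff.differentiable h (by simp)) (x, t)).hasFDerivAt
  have h2 : HasDerivAt (fun y : ℝ => (x, y)) ((0 : ℝ), (1 : ℝ)) t :=
    (hasDerivAt_const t x).prodMk (hasDerivAt_id t)
  exact h1.comp_hasDerivAt t h2

lemma Sm.hx {f : ℝ → ℝ → ℝ} (h : Sm f) (x t : ℝ) :
    HasDerivAt (fun y => f y t) (pdx f x t) x :=
  (h.pdx_eq x t).differentiableAt.hasDerivAt

lemma Sm.ht {f : ℝ → ℝ → ℝ} (h : Sm f) (x t : ℝ) :
    HasDerivAt (fun s => f x s) (pdt f x t) t :=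
  (h.pdt_eq x t).differentiableAt.hasDerivAt

lemma Sm.px {f : ℝ → ℝ → ℝ} (h : Sm f) : Sm (pdx f) := by
  have e : (fun q : ℝ × ℝ => pdx f q.1 q.2)
      = fun q => fderiv ℝ (fun q : ℝ × ℝ => f q.1 q.2) q (1, 0) := by
    funext q
    exact (h.pdx_eq q.1 q.2).deriv
  unfold Sm
  rw [e]
  exact (ContDiff.fderiv_right h (by simp)).clm_apply contDiff_const

lemma Sm.pt {f : ℝ → ℝ → ℝ} (h : Sm f) : Sm (pdt f) := by
  have e : (fun q : ℝ × ℝ => pdt f q.1 q.2)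
      = fun q => fderiv ℝ (fun q : ℝ × ℝ => f q.1 q.2) q (0, 1) := by
    funext q
    exact (h.pdt_eq q.1 q.2).deriv
  unfold Sm
  rw [e]
  exact (ContDiff.fderiv_right h (by simp)).clm_apply contDiff_const

lemma Sm.comm {f : ℝ → ℝ → ℝ} (h : Sm f) : pdt (pdx f) = pdx (pdt f) := by
  have e1 : (fun q : ℝ × ℝ => pdx f q.1 q.2)
      = fun q => fderiv ℝ (fun q : ℝ × ℝ => f q.1 q.2) q (1, 0) := by
    funext q
    exact (h.pdx_eq q.1 q.2).deriv
  have e2 : (fun q : ℝ × ℝ => pdt f q.1 q.2)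
      = fun q => fderiv ℝ (fun q : ℝ × ℝ => f q.1 q.2) q (0, 1) := by
    funext q
    exact (h.pdt_eq q.1 q.2).deriv
  have hd : Differentiable ℝ (fderiv ℝ (fun q : ℝ × ℝ => f q.1 q.2)) :=
    (ContDiff.fderiv_right (m := 1) h (by norm_cast)).differentiable (by simp)
  funext x t
  have a1 : pdt (pdx f) x t = _ := (h.px.pdt_eq x t).deriv
  have a2 : pdx (pdt f) x t = _ := (h.pt.pdx_eq x t).deriv
  rw [a1, a2, e1, e2]
  rw [fderiv_clm_apply (hd _) (by fun_prop), fderiv_clm_apply (hd _) (by fun_prop)]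
  simp
  have hs : IsSymmSndFDerivAt ℝ (fun q : ℝ × ℝ => f q.1 q.2) (x, t) :=
    (ContDiff.contDiffAt h).isSymmSndFDerivAt
      (by simp only [minSmoothness_of_isRCLikeNormedField]; norm_cast)
  exact hs _ _

lemma Sm.sub {f g : ℝ → ℝ → ℝ} (hf : Sm f) (hg : Sm g) : Sm (fun x t => f x t - g x t) :=
  ContDiff.sub hf hg
lemma Sm.mul {f g : ℝ → ℝ → ℝ} (hf : Sm f) (hg : Sm g) : Sm (fun x t => f x t * g x t) :=
  ContDiff.mul hf hg
lemma Sm.pow {f : ℝ → ℝ → ℝ} (hf : Sm f) (n : ℕ) : Sm (fun x t => f x t ^ n) :=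
  ContDiff.pow hf n

lemma Sm.pdx_sub {f g : ℝ → ℝ → ℝ} (hf : Sm f) (hg : Sm g) :
    pdx (fun x t => f x t - g x t) = fun x t => pdx f x t - pdx g x t := by
  funext x t
  exact ((hf.hx x t).sub (hg.hx x t)).deriv
lemma Sm.pdt_sub {f g : ℝ → ℝ → ℝ} (hf : Sm f) (hg : Sm g) :
    pdt (fun x t => f x t - g x t) = fun x t => pdt f x t - pdt g x t := by
  funext x t
  exact ((hf.ht x t).sub (hg.ht x t)).deriv

/-- A derivative of a function vanishing on a closed interval vanishes there. -/
lemma deriv_zero_Icc {f : ℝ → ℝ} {f' a b x : ℝ} (hab : a < b) (h : ∀ y ∈ Icc a b, f y = 0)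
    (hx : x ∈ Icc a b) (hf : HasDerivAt f f' x) : f' = 0 := by
  have h1 := hf.hasDerivWithinAt (s := Icc a b)
  have h2 : HasDerivWithinAt f 0 (Icc a b) x :=
    (hasDerivWithinAt_const x (Icc a b) (0 : ℝ)).congr h (h x hx)
  exact (uniqueDiffOn_Icc hab x hx).eq_deriv _ h1 h2

lemma cont_slice {f : ℝ → ℝ → ℝ} (h : Continuous (fun q : ℝ × ℝ => f q.1 q.2)) (t : ℝ) :
    Continuous (fun x => f x t) :=
  h.comp (by fun_prop : Continuous fun x : ℝ => (x, t))

/-- Joint continuity of the primitive. -/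
lemma cont_prim {f : ℝ → ℝ → ℝ} (h : Continuous (fun q : ℝ × ℝ => f q.1 q.2)) :
    Continuous (fun q : ℝ × ℝ => ∫ ξ in (0:ℝ)..q.1, f ξ q.2) := by
  apply intervalIntegral.continuous_parametric_intervalIntegral_of_continuous
    (f := fun (q : ℝ × ℝ) ξ => f ξ q.2)
  · exact h.comp (by fun_prop : Continuous fun r : (ℝ × ℝ) × ℝ => (r.2, r.1.2))
  · fun_prop

/-- Differentiation under the integral. -/
lemma deriv_int {f f' : ℝ → ℝ → ℝ} (hf : Continuous (fun q : ℝ × ℝ => f q.1 q.2))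
    (hf' : Continuous (fun q : ℝ × ℝ => f' q.1 q.2))
    (hd : ∀ x t, HasDerivAt (fun s => f x s) (f' x t) t) (a b t : ℝ) :
    HasDerivAt (fun s => ∫ x in a..b, f x s) (∫ x in a..b, f' x t) t := by
  obtain ⟨C, hC⟩ := (isCompact_uIcc (a := a) (b := b)).prod
    (isCompact_Icc (a := t - 1) (b := t + 1)) |>.exists_bound_of_continuousOn hf'.continuousOn
  have := intervalIntegral.hasDerivAt_integral_of_dominated_loc_of_deriv_le
    (μ := volume) (F := fun s x => f x s) (F' := fun s x => f' x s) (x₀ := t)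
    (a := a) (b := b) (s := Icc (t - 1) (t + 1)) (bound := fun _ => C)
    (Icc_mem_nhds (by linarith) (by linarith))
    (Filter.Eventually.of_forall fun s => (cont_slice hf s).aestronglyMeasurable)
    ((cont_slice hf t).intervalIntegrable _ _)
    ((cont_slice hf' t).aestronglyMeasurable)
    (Filter.Eventually.of_forall fun x hx s hs => hC (x, s) ⟨uIoc_subset_uIcc hx, hs⟩)
    intervalIntegrable_const
    (Filter.Eventually.of_forall fun x hx s hs => hd x s)
  exact this.2

/-- Cauchy-Schwarz for primitives. -/
lemma cs_prim {f : ℝ → ℝ} (hf : Continuous f) {L x : ℝ} (hL : 0 < L) (hx : x ∈ Icc 0 L) :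
    (∫ ξ in (0:ℝ)..x, f ξ) ^ 2 ≤ L * ∫ ξ in (0:ℝ)..L, f ξ ^ 2 := by
  set s := ∫ ξ in (0:ℝ)..x, f ξ with hs
  have h0 : 0 ≤ ∫ ξ in (0:ℝ)..x, (L * f ξ - s) ^ 2 :=
    intervalIntegral.integral_nonneg hx.1 (fun _ _ => sq_nonneg _)
  have e : ∫ ξ in (0:ℝ)..x, (L * f ξ - s) ^ 2
      = L ^ 2 * (∫ ξ in (0:ℝ)..x, f ξ ^ 2) - 2 * L * s * s + x * s ^ 2 := by
    have : ∀ ξ, (L * f ξ - s) ^ 2 = L ^ 2 * f ξ ^ 2 - 2 * L * s * f ξ + s ^ 2 := fun ξ => by ring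
    simp_rw [this]
    rw [intervalIntegral.integral_add, intervalIntegral.integral_sub,
      intervalIntegral.integral_const_mul, intervalIntegral.integral_const_mul,
      intervalIntegral.integral_const, ← hs]
    · simp
    all_goals exact Continuous.intervalIntegrable (by fun_prop) _ _
  have hmono : ∫ ξ in (0:ℝ)..x, f ξ ^ 2 ≤ ∫ ξ in (0:ℝ)..L, f ξ ^ 2 := by
    apply intervalIntegral.integral_mono_interval le_rfl hx.1 hx.2
    · exact Filter.Eventually.of_forall fun _ => sq_nonneg _
    · exact Continuous.intervalIntegrable (by fun_prop) _ _
  rw [e] at h0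
  have h1 : L * s ^ 2 ≤ L * (L * ∫ ξ in (0:ℝ)..x, f ξ ^ 2) := by
    nlinarith [mul_le_mul_of_nonneg_right hx.2 (sq_nonneg s)]
  have h2 := le_of_mul_le_mul_left h1 hL
  nlinarith

lemma gronwall_zero {E E' : ℝ → ℝ} {T C : ℝ} (hE : ∀ t, HasDerivAt E (E' t) t)
    (h0 : E 0 = 0) (hn : ∀ t ∈ Icc 0 T, 0 ≤ E t) (hle : ∀ t ∈ Icc 0 T, E' t ≤ C * E t) :
    ∀ t ∈ Icc 0 T, E t = 0 := by
  intro t ht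
  have hd : ∀ s, HasDerivAt (fun s => Real.exp (-C * s) * E s)
      (Real.exp (-C * s) * (-C) * E s + Real.exp (-C * s) * E' s) s := by
    intro s
    have : HasDerivAt (fun s => Real.exp (-C * s)) (Real.exp (-C * s) * (-C)) s := by
      have := ((hasDerivAt_id s).const_mul (-C)).exp
      simpa using this
    exact this.mul (hE s)
  have ha : AntitoneOn (fun s => Real.exp (-C * s) * E s) (Icc 0 T) := by
    apply antitoneOn_of_deriv_nonpos (convex_Icc 0 T)
    · exact fun s _ => (hd s).continuousAt.continuousWithinAt
    · exact fun s _ => (hd s).differentiableAt.differentiableWithinAt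
    · intro s hs
      rw [interior_Icc] at hs
      rw [(hd s).deriv]
      have := hle s ⟨hs.1.le, hs.2.le⟩
      nlinarith [Real.exp_pos (-C * s)]
  have := ha ⟨le_rfl, ht.1.trans ht.2⟩ ht ht.1
  simp only [h0, mul_zero] at this
  have h3 := hn t ht
  by_contra hne
  have : 0 < E t := lt_of_le_of_ne h3 (Ne.symm hne)
  nlinarith [mul_pos (Real.exp_pos (-C * t)) this]

lemma Sm.mk_add {f g : ℝ → ℝ → ℝ} (hf : Sm f) (hg : Sm g) : Sm (fun x t => f x t + g x t) :=
  ContDiff.add hf hg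

lemma hasDerivAt_prim {f : ℝ → ℝ} (hf : Continuous f) (x : ℝ) :
    HasDerivAt (fun y => ∫ ξ in (0:ℝ)..y, f ξ) (f x) x :=
  intervalIntegral.integral_hasDerivAt_right (hf.intervalIntegrable _ _)
    (hf.stronglyMeasurableAtFilter _ _) hf.continuousAt

lemma hasDerivAt_coprim {f : ℝ → ℝ} (hf : Continuous f) (L x : ℝ) :
    HasDerivAt (fun y => ∫ ξ in y..L, f ξ) (- f x) x :=
  intervalIntegral.integral_hasDerivAt_left (hf.intervalIntegrable _ _)
    (hf.stronglyMeasurableAtFilter _ _) hf.continuousAt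

lemma weak_form {L D k2 T : ℝ} {p w : ℝ → ℝ → ℝ} (hL : 0 < L) (hT : 0 < T) (hw : Sm w)
    (hp : Sm p) (hsol : IsFullSol L D k2 T p w) {t : ℝ} (ht : t ∈ Icc 0 T)
    {φ φ1 φ2 : ℝ → ℝ} (hφ : ∀ x, HasDerivAt φ (φ1 x) x) (hφ1 : ∀ x, HasDerivAt φ1 (φ2 x) x)
    (hφ2 : Continuous φ2) (z0 : φ 0 = 0) (z1 : φ1 0 = 0) :
    ∫ x in (0:ℝ)..L, ((pdt (pdt w) x t - p x t) * φ x
      + D * ((pdx (pdx w) x t) ^ 2 * pdx w x t) * φ1 x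
      + (D * pdx (pdx w) x t + k2 * pdx (pdx (pdt w)) x t
          + D * ((pdx w x t) ^ 2 * pdx (pdx w) x t)) * φ2 x
      + (∫ ξ in (0:ℝ)..x, ((pdx (pdt w) ξ t) ^ 2 + pdx w ξ t * pdx (pdt (pdt w)) ξ t))
        * (∫ ξ in (0:ℝ)..x, pdx w ξ t * φ1 ξ)) = 0 := by
  obtain ⟨-, hpde, hbc⟩ := hsol
  have c0 : Continuous φ := continuous_iff_continuousAt.2 fun x => (hφ x).continuousAt
  have c1 : Continuous φ1 := continuous_iff_continuousAt.2 fun x => (hφ1 x).continuousAt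
  have w1 := hw.px
  have w2 := w1.px
  have w3 := w2.px
  have wt := hw.pt
  have wt1 := wt.px
  have wt2 := wt1.px
  have wt3 := wt2.px
  have wtt := wt.pt
  have wtt1 := wtt.px
  have e1 : pdt (pdx w) = pdx (pdt w) := hw.comm
  have e2 : pdt (pdx (pdt w)) = pdx (pdt (pdt w)) := wt.comm
  have e3 : pdt (pdx (pdx w)) = pdx (pdx (pdt w)) := by rw [w1.comm, e1]
  have e4 : pdt (pdx (pdx (pdx w))) = pdx (pdx (pdx (pdt w))) := by rw [w2.comm, e3]
  -- the integrand of u_tt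
  have cI : Continuous fun ξ => (pdx (pdt w) ξ t) ^ 2 + pdx w ξ t * pdx (pdt (pdt w)) ξ t :=
    ((wt1.contx t).pow 2).add ((w1.contx t).mul (wtt1.contx t))
  have hutt : ∀ x, uttF w x t =
      -∫ ξ in (0:ℝ)..x, ((pdx (pdt w) ξ t) ^ 2 + pdx w ξ t * pdx (pdt (pdt w)) ξ t) := by
    intro x
    simp only [uttF, e1, e2]
  have cIp : Continuous fun x => ∫ ξ in (0:ℝ)..x,
      ((pdx (pdt w) ξ t) ^ 2 + pdx w ξ t * pdx (pdt (pdt w)) ξ t) :=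
    continuous_iff_continuousAt.2 fun x => (hasDerivAt_prim cI x).continuousAt
  have cu : Continuous fun x => uttF w x t := by
    simp only [hutt]
    exact cIp.neg
  have hJ := hasDerivAt_coprim cu L
  have cG : Continuous fun ξ => pdx w ξ t * φ1 ξ := (w1.contx t).mul c1
  have hG := hasDerivAt_prim cG
  have cGp : Continuous fun x => ∫ ξ in (0:ℝ)..x, pdx w ξ t * φ1 ξ :=
    continuous_iff_continuousAt.2 fun x => (hG x).continuousAt
  have sA : Sm (fun y s => (pdx (pdx w) y s) ^ 2 * pdx w y s) := (w2.pow 2).mul w1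
  have sB : Sm (fun y s => (pdx w y s) ^ 2 * pdx (pdx w) y s) := (w1.pow 2).mul w2
  have hK : ∀ x, HasDerivAt (fun y => pdx w y t * ∫ ξ in y..L, uttF w ξ t)
      (pdx (fun y s => pdx w y s * ∫ ξ in y..L, uttF w ξ s) x t) x := fun x =>
    ((w1.hx x t).mul (hJ x)).differentiableAt.hasDerivAt
  set F : ℝ → ℝ := fun x =>
    (D * pdx (pdx (pdx w)) x t + k2 * pdx (pdx (pdx (pdt w))) x t
      - D * ((pdx (pdx w) x t) ^ 2 * pdx w x t)
      + D * pdx (fun y s => (pdx w y s) ^ 2 * pdx (pdx w) y s) x t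
      + pdx w x t * ∫ ξ in x..L, uttF w ξ t) * φ x
    - (D * pdx (pdx w) x t + k2 * pdx (pdx (pdt w)) x t
          + D * ((pdx w x t) ^ 2 * pdx (pdx w) x t)) * φ1 x
    - (∫ ξ in x..L, uttF w ξ t) * (∫ ξ in (0:ℝ)..x, pdx w ξ t * φ1 ξ) with hF
  set R : ℝ → ℝ := fun x => ((pdt (pdt w) x t - p x t) * φ x
      + D * ((pdx (pdx w) x t) ^ 2 * pdx w x t) * φ1 x
      + (D * pdx (pdx w) x t + k2 * pdx (pdx (pdt w)) x t
          + D * ((pdx w x t) ^ 2 * pdx (pdx w) x t)) * φ2 x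
      + (∫ ξ in (0:ℝ)..x, ((pdx (pdt w) ξ t) ^ 2 + pdx w ξ t * pdx (pdt (pdt w)) ξ t))
        * (∫ ξ in (0:ℝ)..x, pdx w ξ t * φ1 ξ)) with hR
  have hFd : ∀ x ∈ Icc (0:ℝ) L, HasDerivAt F (- R x) x := by
    intro x hx
    have hN := (((((w3.hx x t).const_mul D).add ((wt3.hx x t).const_mul k2)).sub
      ((sA.hx x t).const_mul D)).add ((sB.px.hx x t).const_mul D)).add (hK x)
    have hM := (((w2.hx x t).const_mul D).add ((wt2.hx x t).const_mul k2)).add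
      ((sB.hx x t).const_mul D)
    have hh := ((hN.mul (hφ x)).sub (hM.mul (hφ1 x))).sub ((hJ x).mul (hG x))
    refine hh.congr_deriv ?_
    have hq := hpde x hx t ht
    have hu := hutt x
    simp only [hR]
    simp only [Pi.add_apply, Pi.sub_apply]
    rw [hu]
    linear_combination (φ x) * hq
  have cR : Continuous R := by
    have := wtt.contx t
    have := hp.contx t
    have := w1.contx t
    have := w2.contx t
    have := wt2.contx t
    simp only [hR]
    fun_prop
  have hFint : ∫ x in (0:ℝ)..L, - R x = F L - F 0 := by
    apply intervalIntegral.integral_eq_sub_of_hasDerivAt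
    · intro x hx
      rw [uIcc_of_le hL.le] at hx
      exact hFd x hx
    · exact cR.neg.intervalIntegrable _ _
  have hF0 : F 0 = 0 := by simp [hF, z0, z1]
  have b2 : pdx (pdx w) L t = 0 := (hbc t ht).2.2.1
  have b3 : pdx (pdx (pdx w)) L t = 0 := (hbc t ht).2.2.2
  have bt2 : pdx (pdx (pdt w)) L t = 0 := by
    rw [← e3]
    exact deriv_zero_Icc hT (fun s hs => (hbc s hs).2.2.1) ht (w2.ht L t)
  have bt3 : pdx (pdx (pdx (pdt w))) L t = 0 := by
    rw [← e4]
    exact deriv_zero_Icc hT (fun s hs => (hbc s hs).2.2.2) ht (w3.ht L t)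
  have bB : pdx (fun y s => (pdx w y s) ^ 2 * pdx (pdx w) y s) L t = 0 := by
    have := (((w1.hx L t).pow 2).mul (w2.hx L t)).deriv
    refine Eq.trans this ?_
    simp [b2, b3]
  have hFL : F L = 0 := by simp [hF, b2, b3, bt2, bt3, bB]
  rw [hF0, hFL, intervalIntegral.integral_neg] at hFint
  linarith

lemma young {δ : ℝ} (hδ : 0 < δ) (a b : ℝ) : -(2 * a * b) ≤ δ * b ^ 2 + a ^ 2 / δ := by
  have : 0 ≤ (δ * b + a) ^ 2 / δ := by positivity
  have e : (δ * b + a) ^ 2 / δ = δ * b ^ 2 + a ^ 2 / δ + 2 * a * b := by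
    field_simp
    ring
  linarith

lemma cs_prim_bdd {f : ℝ → ℝ} (hf : Continuous f) {L x M : ℝ} (hL : 0 < L) (hx : x ∈ Icc 0 L)
    (hM : ∀ ξ ∈ Icc 0 L, f ξ ^ 2 ≤ M) :
    (∫ ξ in (0:ℝ)..x, f ξ) ^ 2 ≤ L * (L * M) := by
  refine (cs_prim hf hL hx).trans (mul_le_mul_of_nonneg_left ?_ hL.le)
  have : ∫ ξ in (0:ℝ)..L, f ξ ^ 2 ≤ ∫ ξ in (0:ℝ)..L, M :=
    intervalIntegral.integral_mono_on hL.le ((hf.pow 2).intervalIntegrable _ _)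
      intervalIntegrable_const hM
  simpa using this

set_option maxHeartbeats 1000000 in
lemma pt_bound {L D K δ a y b q A B g P1 P2 P3 c1 c2 c3 c4 c5 : ℝ} (hL : 0 < L)
    (hδ : 0 < δ) (hA : 0 ≤ A) (hB : 0 ≤ B)
    (h1 : c1 ^ 2 ≤ K ^ 2) (h2 : c2 ^ 2 ≤ K ^ 2) (h3 : c3 ^ 2 ≤ K ^ 2) (h4 : c4 ^ 2 ≤ K ^ 2)
    (h5 : c5 ^ 2 ≤ K ^ 2) (hy : y ^ 2 ≤ L * A) (hq : q ^ 2 ≤ L * B)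
    (hP1 : P1 ^ 2 ≤ L * (L * (L * B * K ^ 2))) (hP2 : P2 ^ 2 ≤ L * (L * (L * A * K ^ 2)))
    (hP3 : P3 ^ 2 ≤ L * (L * (L * A * (L * B)))) :
    -(2 * (D * (c1 * a + c2 * y) * q + D * (c3 * a + c4 * y) * b + g * (P1 + P2) + c5 * P3))
      ≤ δ * (2 + 2 * L + L ^ 3 * K ^ 2) * (b ^ 2 + B)
        + ((2 * D ^ 2 * K ^ 2 + 2 * D ^ 2 * K ^ 2 * L + 1 + K ^ 2 * L ^ 4) / δ
          + L ^ 3 * K ^ 2 + 1) * (a ^ 2 + A + g ^ 2) := by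
  have sq : ∀ c s S : ℝ, c ^ 2 ≤ K ^ 2 → s ^ 2 ≤ S →
      (D * c * s) ^ 2 / δ ≤ D ^ 2 * K ^ 2 * S / δ := by
    intro c s S hc hs
    apply div_le_div_of_nonneg_right _ hδ.le
    have : c ^ 2 * s ^ 2 ≤ K ^ 2 * S := mul_le_mul hc hs (sq_nonneg _) (sq_nonneg _)
    nlinarith [mul_le_mul_of_nonneg_left this (sq_nonneg D)]
  have t1 := young hδ (D * c1 * a) q
  have t2 := young hδ (D * c2 * y) q
  have t3 := young hδ (D * c3 * a) b
  have t4 := young hδ (D * c4 * y) b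
  have t5 := young hδ g P1
  have t6 := young one_pos g P2
  have s1 := sq c1 a _ h1 le_rfl
  have s2 := sq c2 y _ h2 hy
  have s3 := sq c3 a _ h3 le_rfl
  have s4 := sq c4 y _ h4 hy
  have t7 : -(2 * c5 * P3) ≤ δ * B + K ^ 2 * L ^ 4 * A / δ := by
    obtain ⟨X, hX⟩ : ∃ X, X = K ^ 2 * L ^ 4 * A / δ := ⟨_, rfl⟩
    rw [← hX]
    have hX0 : 0 ≤ X := by rw [hX]; positivity
    have hXB : (c5 * P3) ^ 2 ≤ δ * B * X := by
      have : c5 ^ 2 * P3 ^ 2 ≤ K ^ 2 * (L * (L * (L * A * (L * B)))) :=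
        mul_le_mul h5 hP3 (sq_nonneg _) (sq_nonneg _)
      have e : δ * B * X = K ^ 2 * (L * (L * (L * A * (L * B)))) := by
        rw [hX]; field_simp
      rw [e, mul_pow]; exact this
    have hdb : 0 ≤ δ * B := by positivity
    have : (2 * c5 * P3) ^ 2 ≤ (δ * B + X) ^ 2 := by
      have e1 : (2 * c5 * P3) ^ 2 = 4 * (c5 * P3) ^ 2 := by ring
      have e2 : (δ * B + X) ^ 2 = 4 * (δ * B * X) + (δ * B - X) ^ 2 := by ring
      rw [e1, e2]
      linarith [sq_nonneg (δ * B - X)]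
    have := abs_le_of_sq_le_sq' this (by positivity)
    linarith [this.1]
  have u1 : δ * q ^ 2 ≤ δ * (L * B) := mul_le_mul_of_nonneg_left hq hδ.le
  have u2 : δ * P1 ^ 2 ≤ δ * (L * (L * (L * B * K ^ 2))) := mul_le_mul_of_nonneg_left hP1 hδ.le
  have n1 : 0 ≤ δ * (2 * L + L ^ 3 * K ^ 2) * b ^ 2 := by positivity
  have n1' : 0 ≤ δ * B := by positivity
  have n2 : 0 ≤ (2 * D ^ 2 * K ^ 2 * L + 1 + K ^ 2 * L ^ 4) / δ * a ^ 2 := by positivity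
  have n3 : 0 ≤ (2 * D ^ 2 * K ^ 2 + 1) / δ * A := by positivity
  have n4 : 0 ≤ (2 * D ^ 2 * K ^ 2 + 2 * D ^ 2 * K ^ 2 * L + K ^ 2 * L ^ 4) / δ * g ^ 2 := by
    positivity
  have n5 : 0 ≤ (L ^ 3 * K ^ 2 + 1) * a ^ 2 + A + (L ^ 3 * K ^ 2) * g ^ 2 := by positivity
  simp only [div_eq_mul_inv, inv_one, mul_one, one_mul] at *
  linarith

lemma Sm.cont_prim {f : ℝ → ℝ → ℝ} (h : Sm f) :
    Continuous (fun q : ℝ × ℝ => ∫ ξ in (0:ℝ)..q.1, f ξ q.2) := _root_.cont_prim h.cont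

lemma Sm.deriv_int {f f' : ℝ → ℝ → ℝ} (hf : Sm f) (hf' : Sm f')
    (hd : ∀ x t, HasDerivAt (fun s => f x s) (f' x t) t) (a b t : ℝ) :
    HasDerivAt (fun s => ∫ x in a..b, f x s) (∫ x in a..b, f' x t) t :=
  _root_.deriv_int hf.cont hf'.cont hd a b t

set_option maxHeartbeats 4000000 in
lemma smooth_unique (L D k2 T : ℝ) (hL : 0 < L) (hD : 0 < D) (hk2 : 0 < k2) (hT : 0 < T)
    (p w v : ℝ → ℝ → ℝ) (hp : Sm p) (sw : Sm w) (sv : Sm v)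
    (hw : IsFullSol L D k2 T p w) (hv : IsFullSol L D k2 T p v)
    (h0 : ∀ x ∈ Icc (0:ℝ) L, w x 0 = v x 0)
    (h1 : ∀ x ∈ Icc (0:ℝ) L, pdt w x 0 = pdt v x 0) :
    ∀ x ∈ Icc (0:ℝ) L, ∀ t ∈ Icc (0:ℝ) T, w x t = v x t := by
  obtain ⟨z, hz⟩ : ∃ z : ℝ → ℝ → ℝ, z = fun x t => w x t - v x t := ⟨_, rfl⟩
  have sz : Sm z := hz ▸ sw.sub sv
  have ez1 : pdx z = fun x t => pdx w x t - pdx v x t := by rw [hz, sw.pdx_sub sv]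
  have ez2 : pdx (pdx z) = fun x t => pdx (pdx w) x t - pdx (pdx v) x t := by
    rw [ez1, sw.px.pdx_sub sv.px]
  have ezt : pdt z = fun x t => pdt w x t - pdt v x t := by rw [hz, sw.pdt_sub sv]
  have eztt : pdt (pdt z) = fun x t => pdt (pdt w) x t - pdt (pdt v) x t := by
    rw [ezt, sw.pt.pdt_sub sv.pt]
  have ezt1 : pdx (pdt z) = fun x t => pdx (pdt w) x t - pdx (pdt v) x t := by
    rw [ezt, sw.pt.pdx_sub sv.pt]
  have ezt2 : pdx (pdx (pdt z)) = fun x t => pdx (pdx (pdt w)) x t - pdx (pdx (pdt v)) x t := by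
    rw [ezt1, sw.pt.px.pdx_sub sv.pt.px]
  have eztt1 : pdx (pdt (pdt z)) =
      fun x t => pdx (pdt (pdt w)) x t - pdx (pdt (pdt v)) x t := by
    rw [eztt, sw.pt.pt.pdx_sub sv.pt.pt]
  -- commuting
  have k1 : pdt (pdx (pdt z)) = pdx (pdt (pdt z)) := sz.pt.comm
  have k2' : pdt (pdx (pdx z)) = pdx (pdx (pdt z)) := by rw [sz.px.comm, sz.comm]
  have k3 : pdt (pdx w) = pdx (pdt w) := sw.comm
  -- boundary values
  have bz : ∀ t ∈ Icc (0:ℝ) T, z 0 t = 0 := fun t ht => by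
    simp [hz, (hw.2.2 t ht).1, (hv.2.2 t ht).1]
  have bz1 : ∀ t ∈ Icc (0:ℝ) T, pdx z 0 t = 0 := fun t ht => by
    simp [ez1, (hw.2.2 t ht).2.1, (hv.2.2 t ht).2.1]
  have bzt : ∀ t ∈ Icc (0:ℝ) T, pdt z 0 t = 0 := fun t ht =>
    deriv_zero_Icc hT bz ht (sz.ht 0 t)
  have bzt1 : ∀ t ∈ Icc (0:ℝ) T, pdx (pdt z) 0 t = 0 := fun t ht => by
    rw [← sz.comm]
    exact deriv_zero_Icc hT bz1 ht (sz.px.ht 0 t)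
  -- initial values
  have iz : ∀ x ∈ Icc (0:ℝ) L, z x 0 = 0 := fun x hx => by simp [hz, h0 x hx]
  have iz1 : ∀ x ∈ Icc (0:ℝ) L, pdx z x 0 = 0 := fun x hx =>
    deriv_zero_Icc hL iz hx (sz.hx x 0)
  have iz2 : ∀ x ∈ Icc (0:ℝ) L, pdx (pdx z) x 0 = 0 := fun x hx =>
    deriv_zero_Icc hL iz1 hx (sz.px.hx x 0)
  have izt : ∀ x ∈ Icc (0:ℝ) L, pdt z x 0 = 0 := fun x hx => by simp [ezt, h1 x hx]
  have izt1 : ∀ x ∈ Icc (0:ℝ) L, pdx (pdt z) x 0 = 0 := fun x hx =>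
    deriv_zero_Icc hL izt hx (sz.pt.hx x 0)
  -- the nonlocal velocity
  obtain ⟨g, hg⟩ : ∃ g : ℝ → ℝ → ℝ, g = fun x t =>
    ∫ ξ in (0:ℝ)..x, pdx w ξ t * pdx (pdt z) ξ t := ⟨_, rfl⟩
  obtain ⟨gt, hgt⟩ : ∃ g : ℝ → ℝ → ℝ, g = fun x t =>
    ∫ ξ in (0:ℝ)..x, (pdx (pdt w) ξ t * pdx (pdt z) ξ t
      + pdx w ξ t * pdx (pdt (pdt z)) ξ t) := ⟨_, rfl⟩
  have sg0 := sw.px.mul sz.pt.px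
  have sgt0 := (sw.pt.px.mul sz.pt.px).mk_add (sw.px.mul sz.pt.pt.px)
  have cg : Continuous fun q : ℝ × ℝ => g q.1 q.2 := by rw [hg]; exact sg0.cont_prim
  have cgt : Continuous fun q : ℝ × ℝ => gt q.1 q.2 := by rw [hgt]; exact sgt0.cont_prim
  have dg : ∀ x t, HasDerivAt (fun s => g x s) (gt x t) t := by
    intro x t
    rw [hg, hgt]
    refine sg0.deriv_int sgt0 ?_ 0 x t
    intro x t
    have := (sw.px.ht x t).mul (sz.pt.px.ht x t)
    rw [k1, k3] at this
    exact this
  -- energy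
  obtain ⟨e, he⟩ : ∃ e : ℝ → ℝ → ℝ, e = fun x t =>
    pdt z x t ^ 2 + g x t ^ 2 + D * pdx (pdx z) x t ^ 2 := ⟨_, rfl⟩
  obtain ⟨e', he'⟩ : ∃ e : ℝ → ℝ → ℝ, e = fun x t =>
    2 * pdt z x t * pdt (pdt z) x t + 2 * g x t * gt x t
      + D * (2 * pdx (pdx z) x t * pdx (pdx (pdt z)) x t) := ⟨_, rfl⟩
  have jz1 := sz.px.cont
  have jz2 := sz.px.px.cont
  have jzt := sz.pt.cont
  have jztt := sz.pt.pt.cont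
  have jzt2 := sz.pt.px.px.cont
  have jw1 := sw.px.cont
  have jw2 := sw.px.px.cont
  have jv1 := sv.px.cont
  have jv2 := sv.px.px.cont
  have jvt1 := sv.pt.px.cont
  have jvtt1 := sv.pt.pt.px.cont
  have ce : Continuous fun q : ℝ × ℝ => e q.1 q.2 := by rw [he]; fun_prop
  have ce' : Continuous fun q : ℝ × ℝ => e' q.1 q.2 := by rw [he']; fun_prop
  have de : ∀ x t, HasDerivAt (fun s => e x s) (e' x t) t := by
    intro x t
    rw [he, he']
    have := (((sz.pt.ht x t).pow 2).add ((dg x t).pow 2)).add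
      (((sz.px.px.ht x t).pow 2).const_mul D)
    refine this.congr_deriv ?_
    rw [k2']
    push_cast
    ring
  have dE := deriv_int ce ce' de 0 L
  have jq : Continuous fun q : ℝ × ℝ => ∫ ξ in (0:ℝ)..q.1,
      ((pdx (pdt v) ξ q.2) ^ 2 + pdx v ξ q.2 * pdx (pdt (pdt v)) ξ q.2) :=
    ((sv.pt.px.pow 2).mk_add (sv.px.mul sv.pt.pt.px)).cont_prim
  have bd : ∀ f : ℝ → ℝ → ℝ, Continuous (fun q : ℝ × ℝ => f q.1 q.2) →
      ∃ K, 0 ≤ K ∧ ∀ x ∈ Icc (0:ℝ) L, ∀ t ∈ Icc (0:ℝ) T, |f x t| ≤ K := by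
    intro f hf
    obtain ⟨K, hK⟩ := ((isCompact_Icc (a := (0:ℝ)) (b := L)).prod
      (isCompact_Icc (a := (0:ℝ)) (b := T))).exists_bound_of_continuousOn hf.continuousOn
    refine ⟨|K|, abs_nonneg _, fun x hx t ht => (hK (x, t) ⟨hx, ht⟩).trans (le_abs_self _)⟩
  obtain ⟨K1, p1, B1⟩ := bd (fun x t => (pdx (pdx w) x t + pdx (pdx v) x t) * pdx w x t)
    (by fun_prop)
  obtain ⟨K2, p2, B2⟩ := bd (fun x t => pdx (pdx v) x t ^ 2) (by fun_prop)
  obtain ⟨K3, p3, B3⟩ := bd (fun x t => pdx w x t ^ 2) (by fun_prop)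
  obtain ⟨K4, p4, B4⟩ := bd (fun x t => (pdx w x t + pdx v x t) * pdx (pdx v) x t)
    (by fun_prop)
  obtain ⟨K5, p5, B5⟩ := bd (fun x t => ∫ ξ in (0:ℝ)..x,
      ((pdx (pdt v) ξ t) ^ 2 + pdx v ξ t * pdx (pdt (pdt v)) ξ t)) jq
  obtain ⟨K6, p6, B6⟩ := bd (pdx (pdt v)) (by fun_prop)
  obtain ⟨K7, p7, B7⟩ := bd (pdx (pdt (pdt v))) (by fun_prop)
  obtain ⟨K, hK⟩ : ∃ K, K = K1 + K2 + K3 + K4 + K5 + K6 + K7 := ⟨_, rfl⟩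
  have hK0 : 0 ≤ K := by rw [hK]; positivity
  have toK : ∀ {c k : ℝ}, |c| ≤ k → k ≤ K → c ^ 2 ≤ K ^ 2 := by
    intro c k h h'
    exact sq_le_sq' (by linarith [neg_abs_le c]) (by linarith [le_abs_self c])
  have hden : 0 < 2 + 2 * L + L ^ 3 * K ^ 2 := by positivity
  obtain ⟨δ, hδ⟩ : ∃ δ, δ = 2 * k2 / ((1 + L) * (2 + 2 * L + L ^ 3 * K ^ 2)) := ⟨_, rfl⟩
  have hδ0 : 0 < δ := by rw [hδ]; positivity
  have hδ1 : δ * (2 + 2 * L + L ^ 3 * K ^ 2) * (1 + L) = 2 * k2 := by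
    rw [hδ]; field_simp
  obtain ⟨C, hC⟩ : ∃ C, C = ((2 * D ^ 2 * K ^ 2 + 2 * D ^ 2 * K ^ 2 * L + 1 + K ^ 2 * L ^ 4) / δ
          + L ^ 3 * K ^ 2 + 1) := ⟨_, rfl⟩
  have hC0 : 0 ≤ C := by rw [hC]; positivity
  -- Poincare bounds
  have poin1 : ∀ t ∈ Icc (0:ℝ) T, ∀ x ∈ Icc (0:ℝ) L,
      pdx z x t ^ 2 ≤ L * ∫ ξ in (0:ℝ)..L, pdx (pdx z) ξ t ^ 2 := by
    intro t ht x hx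
    have h := cs_prim (sz.px.px.contx t) hL hx
    rwa [intervalIntegral.integral_eq_sub_of_hasDerivAt (fun y _ => sz.px.hx y t)
      ((sz.px.px.contx t).intervalIntegrable _ _), bz1 t ht, sub_zero] at h
  have poin2 : ∀ t ∈ Icc (0:ℝ) T, ∀ x ∈ Icc (0:ℝ) L,
      pdx (pdt z) x t ^ 2 ≤ L * ∫ ξ in (0:ℝ)..L, pdx (pdx (pdt z)) ξ t ^ 2 := by
    intro t ht x hx
    have h := cs_prim (sz.pt.px.px.contx t) hL hx
    rwa [intervalIntegral.integral_eq_sub_of_hasDerivAt (fun y _ => sz.pt.px.hx y t)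
      ((sz.pt.px.px.contx t).intervalIntegrable _ _), bzt1 t ht, sub_zero] at h
  have key : ∀ t ∈ Icc (0:ℝ) T, (∫ x in (0:ℝ)..L, e' x t)
      ≤ C * (1 + L) * (1 + 1 / D) * ∫ x in (0:ℝ)..L, e x t := by
    intro t ht
    obtain ⟨A, hA⟩ : ∃ A, A = ∫ ξ in (0:ℝ)..L, pdx (pdx z) ξ t ^ 2 := ⟨_, rfl⟩
    obtain ⟨B, hB⟩ : ∃ A, A = ∫ ξ in (0:ℝ)..L, pdx (pdx (pdt z)) ξ t ^ 2 := ⟨_, rfl⟩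
    have hA0 : 0 ≤ A := by
      rw [hA]; exact intervalIntegral.integral_nonneg hL.le fun _ _ => sq_nonneg _
    have hB0 : 0 ≤ B := by
      rw [hB]; exact intervalIntegral.integral_nonneg hL.le fun _ _ => sq_nonneg _
    have Ww := weak_form hL hT sw hp hw ht (fun x => sz.pt.hx x t) (fun x => sz.pt.px.hx x t)
      (sz.pt.px.px.contx t) (bzt t ht) (bzt1 t ht)
    have Wv := weak_form hL hT sv hp hv ht (fun x => sz.pt.hx x t) (fun x => sz.pt.px.hx x t)
      (sz.pt.px.px.contx t) (bzt t ht) (bzt1 t ht)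
    have cw1 := sw.px.contx t
    have cw2 := sw.px.px.contx t
    have cwt1 := sw.pt.px.contx t
    have cwt2 := sw.pt.px.px.contx t
    have cwtt := sw.pt.pt.contx t
    have cwtt1 := sw.pt.pt.px.contx t
    have cv1 := sv.px.contx t
    have cv2 := sv.px.px.contx t
    have cvt1 := sv.pt.px.contx t
    have cvt2 := sv.pt.px.px.contx t
    have cvtt := sv.pt.pt.contx t
    have cvtt1 := sv.pt.pt.px.contx t
    have cz1 := sz.px.contx t
    have cz2 := sz.px.px.contx t
    have czt := sz.pt.contx t
    have czt1 := sz.pt.px.contx t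
    have czt2 := sz.pt.px.px.contx t
    have czt3 := sz.pt.pt.px.contx t
    have cp := hp.contx t
    have cprim : ∀ f : ℝ → ℝ, Continuous f → Continuous fun x => ∫ ξ in (0:ℝ)..x, f ξ :=
      fun f hf => continuous_iff_continuousAt.2 fun x => (hasDerivAt_prim hf x).continuousAt
    have cIw := cprim (fun ξ => (pdx (pdt w) ξ t) ^ 2 + pdx w ξ t * pdx (pdt (pdt w)) ξ t)
      (by fun_prop)
    have cIv := cprim (fun ξ => (pdx (pdt v) ξ t) ^ 2 + pdx v ξ t * pdx (pdt (pdt v)) ξ t)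
      (by fun_prop)
    have cGw := cprim (fun ξ => pdx w ξ t * pdx (pdt z) ξ t) (by fun_prop)
    have cGv := cprim (fun ξ => pdx v ξ t * pdx (pdt z) ξ t) (by fun_prop)
    obtain ⟨fw, hfw⟩ : ∃ f : ℝ → ℝ, f = fun x => ((pdt (pdt w) x t - p x t) * pdt z x t
      + D * ((pdx (pdx w) x t) ^ 2 * pdx w x t) * pdx (pdt z) x t
      + (D * pdx (pdx w) x t + k2 * pdx (pdx (pdt w)) x t
          + D * ((pdx w x t) ^ 2 * pdx (pdx w) x t)) * pdx (pdx (pdt z)) x t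
      + (∫ ξ in (0:ℝ)..x, ((pdx (pdt w) ξ t) ^ 2 + pdx w ξ t * pdx (pdt (pdt w)) ξ t))
        * (∫ ξ in (0:ℝ)..x, pdx w ξ t * pdx (pdt z) ξ t)) := ⟨_, rfl⟩
    obtain ⟨fv, hfv⟩ : ∃ f : ℝ → ℝ, f = fun x => ((pdt (pdt v) x t - p x t) * pdt z x t
      + D * ((pdx (pdx v) x t) ^ 2 * pdx v x t) * pdx (pdt z) x t
      + (D * pdx (pdx v) x t + k2 * pdx (pdx (pdt v)) x t
          + D * ((pdx v x t) ^ 2 * pdx (pdx v) x t)) * pdx (pdx (pdt z)) x t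
      + (∫ ξ in (0:ℝ)..x, ((pdx (pdt v) ξ t) ^ 2 + pdx v ξ t * pdx (pdt (pdt v)) ξ t))
        * (∫ ξ in (0:ℝ)..x, pdx v ξ t * pdx (pdt z) ξ t)) := ⟨_, rfl⟩
    have cfw : Continuous fw := by rw [hfw]; fun_prop
    have cfv : Continuous fv := by rw [hfv]; fun_prop
    have Iw : ∫ x in (0:ℝ)..L, fw x = 0 := by rw [hfw]; exact Ww
    have Iv : ∫ x in (0:ℝ)..L, fv x = 0 := by rw [hfv]; exact Wv
    have cgs := cont_slice cg t
    have ce1s := cont_slice ce' t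
    have ces := cont_slice ce t
    have ptw : ∀ x ∈ Icc (0:ℝ) L, e' x t - 2 * (fw x - fv x)
        ≤ -(2 * k2) * pdx (pdx (pdt z)) x t ^ 2
          + δ * (2 + 2 * L + L ^ 3 * K ^ 2) * (pdx (pdx (pdt z)) x t ^ 2 + B)
          + C * (pdx (pdx z) x t ^ 2 + A + g x t ^ 2) := by
      intro x hx
      obtain ⟨P1, hP1⟩ : ∃ P, P = ∫ ξ in (0:ℝ)..x, pdx (pdt z) ξ t * pdx (pdt v) ξ t := ⟨_, rfl⟩
      obtain ⟨P2, hP2⟩ : ∃ P, P = ∫ ξ in (0:ℝ)..x, pdx z ξ t * pdx (pdt (pdt v)) ξ t := ⟨_, rfl⟩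
      obtain ⟨P3, hP3⟩ : ∃ P, P = ∫ ξ in (0:ℝ)..x, pdx z ξ t * pdx (pdt z) ξ t := ⟨_, rfl⟩
      obtain ⟨JV, hJV⟩ : ∃ P, P = ∫ ξ in (0:ℝ)..x,
        ((pdx (pdt v) ξ t) ^ 2 + pdx v ξ t * pdx (pdt (pdt v)) ξ t) := ⟨_, rfl⟩
      obtain ⟨JW, hJW⟩ : ∃ P, P = ∫ ξ in (0:ℝ)..x,
        ((pdx (pdt w) ξ t) ^ 2 + pdx w ξ t * pdx (pdt (pdt w)) ξ t) := ⟨_, rfl⟩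
      obtain ⟨H, hH⟩ : ∃ P, P = ∫ ξ in (0:ℝ)..x, pdx v ξ t * pdx (pdt z) ξ t := ⟨_, rfl⟩
      have hgx : g x t = ∫ ξ in (0:ℝ)..x, pdx w ξ t * pdx (pdt z) ξ t := by rw [hg]
      have id1 : g x t = H + P3 := by
        rw [hgx, hH, hP3, ← intervalIntegral.integral_add]
        · congr 1; funext ξ; simp only [ez1]; ring
        all_goals exact Continuous.intervalIntegrable (by fun_prop) _ _
      have id2 : JW = gt x t + JV + P1 + P2 := by
        rw [hJW, hgt, hJV, hP1, hP2, ← intervalIntegral.integral_add,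
          ← intervalIntegral.integral_add, ← intervalIntegral.integral_add]
        · congr 1; funext ξ; simp only [ez1, ezt1, eztt1]; ring
        all_goals exact Continuous.intervalIntegrable (by fun_prop) _ _
      have q1 : P1 ^ 2 ≤ L * (L * (L * B * K ^ 2)) := by
        rw [hP1]
        apply cs_prim_bdd (by fun_prop) hL hx
        intro ξ hξ
        rw [mul_pow]
        refine mul_le_mul ?_ (toK (B6 ξ hξ t ht) (by linarith)) (sq_nonneg _) (by positivity)
        rw [hB]; exact poin2 t ht ξ hξ
      have q2 : P2 ^ 2 ≤ L * (L * (L * A * K ^ 2)) := by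
        rw [hP2]
        apply cs_prim_bdd (by fun_prop) hL hx
        intro ξ hξ
        rw [mul_pow]
        refine mul_le_mul ?_ (toK (B7 ξ hξ t ht) (by linarith)) (sq_nonneg _) (by positivity)
        rw [hA]; exact poin1 t ht ξ hξ
      have q3 : P3 ^ 2 ≤ L * (L * (L * A * (L * B))) := by
        rw [hP3]
        apply cs_prim_bdd (by fun_prop) hL hx
        intro ξ hξ
        rw [mul_pow]
        refine mul_le_mul ?_ ?_ (sq_nonneg _) (by positivity)
        · rw [hA]; exact poin1 t ht ξ hξ
        · rw [hB]; exact poin2 t ht ξ hξ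
      have q4 : pdx z x t ^ 2 ≤ L * A := by rw [hA]; exact poin1 t ht x hx
      have q5 : pdx (pdt z) x t ^ 2 ≤ L * B := by rw [hB]; exact poin2 t ht x hx
      have hmain := pt_bound (D := D) (a := pdx (pdx z) x t) (b := pdx (pdx (pdt z)) x t)
        (g := g x t) hL hδ0 hA0 hB0
        (toK (B1 x hx t ht) (by linarith)) (toK (B2 x hx t ht) (by linarith))
        (toK (B3 x hx t ht) (by linarith)) (toK (B4 x hx t ht) (by linarith))
        (toK (B5 x hx t ht) (by linarith)) q4 q5 q1 q2 q3
      rw [← hC] at hmain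
      rw [add_assoc]
      refine le_trans (le_of_eq ?_)
        (add_le_add (le_refl (-(2 * k2) * pdx (pdx (pdt z)) x t ^ 2)) hmain)
      rw [hfw, hfv, he']
      simp only []
      rw [← hgx, ← hJW, ← hJV, ← hH, id2]
      have r1 : pdt (pdt z) x t = pdt (pdt w) x t - pdt (pdt v) x t := by rw [eztt]
      have r2 : pdx (pdx (pdt z)) x t = pdx (pdx (pdt w)) x t - pdx (pdx (pdt v)) x t := by
        rw [ezt2]
      have r3 : pdx z x t = pdx w x t - pdx v x t := by rw [ez1]
      have r4 : pdx (pdx z) x t = pdx (pdx w) x t - pdx (pdx v) x t := by rw [ez2]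
      have r5 : H = g x t - P3 := by linarith
      rw [r1, r2, r3, r4, r5]
      ring
    have mono := intervalIntegral.integral_mono_on (μ := volume) hL.le
      (f := fun x => e' x t - 2 * (fw x - fv x))
      (g := fun x => -(2 * k2) * pdx (pdx (pdt z)) x t ^ 2
          + δ * (2 + 2 * L + L ^ 3 * K ^ 2) * (pdx (pdx (pdt z)) x t ^ 2 + B)
          + C * (pdx (pdx z) x t ^ 2 + A + g x t ^ 2))
      (Continuous.intervalIntegrable (by fun_prop) _ _)
      (Continuous.intervalIntegrable (by fun_prop) _ _) ptw
    have el : ∫ x in (0:ℝ)..L, (e' x t - 2 * (fw x - fv x)) = ∫ x in (0:ℝ)..L, e' x t := by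
      rw [intervalIntegral.integral_sub, intervalIntegral.integral_const_mul,
        intervalIntegral.integral_sub, Iw, Iv]
      · ring
      all_goals exact Continuous.intervalIntegrable (by fun_prop) _ _
    obtain ⟨G, hG⟩ : ∃ G, G = ∫ x in (0:ℝ)..L, g x t ^ 2 := ⟨_, rfl⟩
    obtain ⟨Z, hZ⟩ : ∃ G, G = ∫ x in (0:ℝ)..L, pdt z x t ^ 2 := ⟨_, rfl⟩
    have hG0 : 0 ≤ G := by
      rw [hG]; exact intervalIntegral.integral_nonneg hL.le fun _ _ => sq_nonneg _
    have hZ0 : 0 ≤ Z := by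
      rw [hZ]; exact intervalIntegral.integral_nonneg hL.le fun _ _ => sq_nonneg _
    have er : ∫ x in (0:ℝ)..L, (-(2 * k2) * pdx (pdx (pdt z)) x t ^ 2
          + δ * (2 + 2 * L + L ^ 3 * K ^ 2) * (pdx (pdx (pdt z)) x t ^ 2 + B)
          + C * (pdx (pdx z) x t ^ 2 + A + g x t ^ 2))
        = -(2 * k2) * B + δ * (2 + 2 * L + L ^ 3 * K ^ 2) * (B + L * B)
          + C * (A + L * A + G) := by
      rw [intervalIntegral.integral_add, intervalIntegral.integral_add,
        intervalIntegral.integral_const_mul, intervalIntegral.integral_const_mul,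
        intervalIntegral.integral_const_mul, intervalIntegral.integral_add,
        intervalIntegral.integral_add, intervalIntegral.integral_add,
        intervalIntegral.integral_const, intervalIntegral.integral_const, ← hA, ← hB, ← hG]
      · simp
      all_goals exact Continuous.intervalIntegrable (by fun_prop) _ _
    have eE : ∫ x in (0:ℝ)..L, e x t = Z + G + D * A := by
      rw [he, intervalIntegral.integral_add, intervalIntegral.integral_add,
        intervalIntegral.integral_const_mul, ← hA, ← hG, ← hZ]
      all_goals exact Continuous.intervalIntegrable (by fun_prop) _ _
    rw [el, er] at mono
    rw [eE]
    refine mono.trans ?_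
    have z1 : δ * (2 + 2 * L + L ^ 3 * K ^ 2) * (B + L * B) = 2 * k2 * B := by
      rw [← hδ1]; ring
    rw [z1]
    have z2 : A + L * A + G ≤ (1 + L) * ((1 + 1 / D) * (Z + G + D * A)) := by
      have : (1 + 1 / D) * (Z + G + D * A) = A + G + (Z + D * A + (Z + G) / D) := by
        field_simp; ring
      rw [this]
      have : 0 ≤ Z + D * A + (Z + G) / D := by positivity
      nlinarith [mul_nonneg hL.le this, mul_nonneg hL.le hG0]
    nlinarith [mul_le_mul_of_nonneg_left z2 hC0]
  have enn : ∀ x t, 0 ≤ e x t := fun x t => by rw [he]; positivity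
  have hE0 : ∫ x in (0:ℝ)..L, e x 0 = 0 := by
    have : ∫ x in (0:ℝ)..L, e x 0 = ∫ x in (0:ℝ)..L, (0:ℝ) := by
      apply intervalIntegral.integral_congr
      intro x hx
      rw [uIcc_of_le hL.le] at hx
      have hgz : g x 0 = 0 := by
        rw [hg]
        have : ∫ ξ in (0:ℝ)..x, pdx w ξ 0 * pdx (pdt z) ξ 0 = ∫ ξ in (0:ℝ)..x, (0:ℝ) := by
          apply intervalIntegral.integral_congr
          intro ξ hξ
          rw [uIcc_of_le hx.1] at hξ
          simp [izt1 ξ ⟨hξ.1, hξ.2.trans hx.2⟩]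
        simpa using this
      simp [he, hgz, izt x hx, iz2 x hx]
    simpa using this
  have hEz := gronwall_zero dE hE0
    (fun t _ => intervalIntegral.integral_nonneg hL.le fun x _ => enn x t) key
  intro x hx t ht
  have hA : ∫ ξ in (0:ℝ)..L, pdx (pdx z) ξ t ^ 2 ≤ 0 := by
    have h2 : ∫ ξ in (0:ℝ)..L, D * pdx (pdx z) ξ t ^ 2 ≤ ∫ ξ in (0:ℝ)..L, e ξ t := by
      apply intervalIntegral.integral_mono_on hL.le
      · exact Continuous.intervalIntegrable (((sz.px.px.contx t).pow 2).const_mul D) _ _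
      · exact (cont_slice ce t).intervalIntegrable _ _
      · intro ξ _
        rw [he]
        nlinarith [sq_nonneg (pdt z ξ t), sq_nonneg (g ξ t)]
    rw [hEz t ht, intervalIntegral.integral_const_mul] at h2
    by_contra hcon
    push Not at hcon
    nlinarith [mul_pos hD hcon]
  have hz1 : ∀ ξ ∈ Icc (0:ℝ) L, pdx z ξ t ^ 2 ≤ 0 := fun ξ hξ =>
    (poin1 t ht ξ hξ).trans (by nlinarith)
  have h := cs_prim_bdd (sz.px.contx t) hL hx hz1
  rw [intervalIntegral.integral_eq_sub_of_hasDerivAt (fun y _ => sz.hx y t)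
      ((sz.px.contx t).intervalIntegrable _ _), bz t ht, sub_zero] at h
  have : z x t = 0 := by
    have : z x t ^ 2 ≤ 0 := by simpa using h
    exact pow_eq_zero_iff (two_ne_zero) |>.1 (le_antisymm this (sq_nonneg _))
  rw [hz] at this
  linarith

/-- Equality of two functions on an open box. -/
def EqBox (a b c d : ℝ) (f g : ℝ → ℝ → ℝ) : Prop :=
  ∀ x ∈ Ioo a b, ∀ t ∈ Ioo c d, f x t = g x t

lemma EqBox.px {a b c d : ℝ} {f g : ℝ → ℝ → ℝ} (h : EqBox a b c d f g) :
    EqBox a b c d (pdx f) (pdx g) := by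
  intro x hx t ht
  apply Filter.EventuallyEq.deriv_eq
  filter_upwards [Ioo_mem_nhds hx.1 hx.2] with y hy using h y hy t ht

lemma EqBox.pt {a b c d : ℝ} {f g : ℝ → ℝ → ℝ} (h : EqBox a b c d f g) :
    EqBox a b c d (pdt f) (pdt g) := by
  intro x hx t ht
  apply Filter.EventuallyEq.deriv_eq
  filter_upwards [Ioo_mem_nhds ht.1 ht.2] with y hy using h x hx y hy

lemma EqBox.int {a b c d : ℝ} {f g : ℝ → ℝ → ℝ} (h : EqBox a b c d f g) {x y t : ℝ}
    (hx : x ∈ Ioo a b) (hy : y ∈ Ioo a b) (ht : t ∈ Ioo c d) :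
    ∫ ξ in x..y, f ξ t = ∫ ξ in x..y, g ξ t := by
  apply intervalIntegral.integral_congr
  intro ξ hξ
  exact h ξ (ordConnected_Ioo.uIcc_subset hx hy hξ) t ht

lemma exists_cutoff {L T : ℝ} (hL : 0 < L) (hT : 0 < T) {w : ℝ → ℝ → ℝ} {U : Set (ℝ × ℝ)}
    (hU : IsOpen U) (hs : Icc (0:ℝ) L ×ˢ Icc (0:ℝ) T ⊆ U)
    (hw : ContDiffOn ℝ (⊤ : ℕ∞) (fun q : ℝ × ℝ => w q.1 q.2) U) :
    ∃ w' : ℝ → ℝ → ℝ, Sm w' ∧ ∃ r > 0, EqBox (-r) (L + r) (-r) (T + r) w' w := by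
  obtain ⟨r, hr, hrU⟩ := (isCompact_Icc.prod isCompact_Icc).exists_cthickening_subset_open hU hs
  have clamp : ∀ {M x : ℝ}, 0 < M → x ∈ Metric.closedBall (M / 2) (M / 2 + r) →
      ∃ y ∈ Icc 0 M, dist x y ≤ r := by
    intro M x hM hx
    rw [Real.closedBall_eq_Icc] at hx
    refine ⟨max 0 (min x M), ⟨le_max_left _ _, max_le hM.le (min_le_right _ _)⟩, ?_⟩
    rw [Real.dist_eq, abs_le]
    have h1 := hx.1
    have h2 := hx.2
    rcases le_total x M with h | h
    · rw [min_eq_left h]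
      rcases le_total 0 x with h' | h'
      · rw [max_eq_right h']; constructor <;> linarith
      · rw [max_eq_left h']; constructor <;> linarith
    · rw [min_eq_right h, max_eq_right hM.le]; constructor <;> linarith
  have hbox : ∀ q : ℝ × ℝ, q.1 ∈ Metric.closedBall (L / 2) (L / 2 + r) →
      q.2 ∈ Metric.closedBall (T / 2) (T / 2 + r) → q ∈ U := by
    intro q h1 h2
    obtain ⟨y, hy, dy⟩ := clamp hL h1
    obtain ⟨s, hs', ds⟩ := clamp hT h2
    apply hrU
    refine Metric.mem_cthickening_of_dist_le q (y, s) r (Icc 0 L ×ˢ Icc 0 T) ⟨hy, hs'⟩ ?_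
    rw [Prod.dist_eq]
    exact max_le dy ds
  let φ : ContDiffBump (L / 2) := ⟨L / 2 + r / 2, L / 2 + r, by linarith, by linarith⟩
  let ψ : ContDiffBump (T / 2) := ⟨T / 2 + r / 2, T / 2 + r, by linarith, by linarith⟩
  refine ⟨fun x t => φ x * ψ t * w x t, ?_, r / 2, by linarith, ?_⟩
  · unfold Sm
    rw [contDiff_iff_contDiffAt]
    intro q
    by_cases hq : q ∈ U
    · have h1 : ContDiffAt ℝ (⊤ : ℕ∞) (fun q : ℝ × ℝ => φ q.1) q :=
        (φ.contDiff.comp contDiff_fst).contDiffAt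
      have h2 : ContDiffAt ℝ (⊤ : ℕ∞) (fun q : ℝ × ℝ => ψ q.2) q :=
        (ψ.contDiff.comp contDiff_snd).contDiffAt
      exact (h1.mul h2).mul (hw.contDiffAt (hU.mem_nhds hq))
    · have hcl : IsClosed (Metric.closedBall (L / 2) (L / 2 + r)
          ×ˢ Metric.closedBall (T / 2) (T / 2 + r)) :=
        Metric.isClosed_closedBall.prod Metric.isClosed_closedBall
      have hn : q ∈ (Metric.closedBall (L / 2) (L / 2 + r)
          ×ˢ Metric.closedBall (T / 2) (T / 2 + r))ᶜ := fun h => hq (hbox q h.1 h.2)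
      apply (contDiffAt_const (c := (0:ℝ))).congr_of_eventuallyEq
      filter_upwards [hcl.isOpen_compl.mem_nhds hn] with y hy
      by_cases h1 : y.1 ∈ Metric.closedBall (L / 2) (L / 2 + r)
      · have h2 : y.2 ∉ Metric.closedBall (T / 2) (T / 2 + r) := fun h => hy ⟨h1, h⟩
        rw [Metric.mem_closedBall, not_le] at h2
        have : ψ y.2 = 0 := ψ.zero_of_le_dist h2.le
        simp [this]
      · rw [Metric.mem_closedBall, not_le] at h1
        have : φ y.1 = 0 := φ.zero_of_le_dist h1.le
        simp [this]
  · intro x hx t ht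
    have h1 : φ x = 1 := by
      apply φ.one_of_mem_closedBall
      rw [Real.closedBall_eq_Icc]
      exact ⟨by simp only [φ]; linarith [hx.1], by simp only [φ]; linarith [hx.2]⟩
    have h2 : ψ t = 1 := by
      apply ψ.one_of_mem_closedBall
      rw [Real.closedBall_eq_Icc]
      exact ⟨by simp only [ψ]; linarith [ht.1], by simp only [ψ]; linarith [ht.2]⟩
    simp [h1, h2]

lemma exists_extension {L D k2 T : ℝ} (hL : 0 < L) (hT : 0 < T) {p w : ℝ → ℝ → ℝ}
    (hw : IsFullSol L D k2 T p w) :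
    ∃ w' : ℝ → ℝ → ℝ, Sm w' ∧ IsFullSol L D k2 T p w' ∧
      ∀ x ∈ Icc (0:ℝ) L, ∀ t ∈ Icc (0:ℝ) T, w' x t = w x t ∧ pdt w' x t = pdt w x t := by
  obtain ⟨⟨U, hU, hsub, hc⟩, hpde, hbc⟩ := hw
  obtain ⟨w', hs, r, hr, hE⟩ := exists_cutoff hL hT hU hsub hc
  have ix : ∀ {x}, x ∈ Icc (0:ℝ) L → x ∈ Ioo (-r) (L + r) := fun {x} hx =>
    ⟨by linarith [hx.1], by linarith [hx.2]⟩
  have it : ∀ {x}, x ∈ Icc (0:ℝ) T → x ∈ Ioo (-r) (T + r) := fun {x} hx =>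
    ⟨by linarith [hx.1], by linarith [hx.2]⟩
  have hEu : EqBox (-r) (L + r) (-r) (T + r) (uttF w') (uttF w) := by
    intro x hx t ht
    unfold uttF
    congr 1
    have h : EqBox (-r) (L + r) (-r) (T + r)
        (fun ξ t => (pdt (pdx w') ξ t) ^ 2 + pdx w' ξ t * pdt (pdt (pdx w')) ξ t)
        (fun ξ t => (pdt (pdx w) ξ t) ^ 2 + pdx w ξ t * pdt (pdt (pdx w)) ξ t) := by
      intro x hx t ht
      simp only [hE.px x hx t ht, hE.px.pt x hx t ht, hE.px.pt.pt x hx t ht]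
    exact h.int (ix ⟨le_rfl, hL.le⟩) hx ht
  have hA : EqBox (-r) (L + r) (-r) (T + r)
      (fun y s => (pdx (pdx w') y s) ^ 2 * pdx w' y s)
      (fun y s => (pdx (pdx w) y s) ^ 2 * pdx w y s) := by
    intro x hx t ht
    simp only [hE.px x hx t ht, hE.px.px x hx t ht]
  have hB : EqBox (-r) (L + r) (-r) (T + r)
      (fun y s => (pdx w' y s) ^ 2 * pdx (pdx w') y s)
      (fun y s => (pdx w y s) ^ 2 * pdx (pdx w) y s) := by
    intro x hx t ht
    simp only [hE.px x hx t ht, hE.px.px x hx t ht]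
  have hJ : EqBox (-r) (L + r) (-r) (T + r)
      (fun y s => pdx w' y s * ∫ ξ in y..L, uttF w' ξ s)
      (fun y s => pdx w y s * ∫ ξ in y..L, uttF w ξ s) := by
    intro x hx t ht
    simp only [hE.px x hx t ht, hEu.int hx (ix ⟨hL.le, le_rfl⟩) ht]
  refine ⟨w', hs, ⟨⟨univ, isOpen_univ, subset_univ _, ContDiff.contDiffOn hs⟩, ?_, ?_⟩, ?_⟩
  · intro x hx t ht
    have := hpde x hx t ht
    rw [hE.pt.pt x (ix hx) t (it ht), hE.px.px.px.px x (ix hx) t (it ht),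
      hE.pt.px.px.px.px x (ix hx) t (it ht), hA.px x (ix hx) t (it ht),
      hB.px.px x (ix hx) t (it ht), hJ.px x (ix hx) t (it ht)]
    exact this
  · intro t ht
    have l0 := ix (x := 0) ⟨le_rfl, hL.le⟩
    have lL := ix (x := L) ⟨hL.le, le_rfl⟩
    rw [hE 0 l0 t (it ht), hE.px 0 l0 t (it ht), hE.px.px L lL t (it ht),
      hE.px.px.px L lL t (it ht)]
    exact hbc t ht
  · intro x hx t ht
    exact ⟨hE x (ix hx) t (it ht), hE.pt x (ix hx) t (it ht)⟩

/-- Uniqueness of classical solutions of the full damped inextensible cantilever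
system (Theorem 5.1): two solutions with the same initial data coincide. -/
theorem full_uniqueness
    (L D k2 T : ℝ) (hL : 0 < L) (hD : 0 < D) (hk2 : 0 < k2) (hT : 0 < T)
    (p w v : ℝ → ℝ → ℝ) (hp : ContDiff ℝ (⊤ : ℕ∞) (fun q : ℝ × ℝ => p q.1 q.2))
    (hw : IsFullSol L D k2 T p w) (hv : IsFullSol L D k2 T p v)
    (h0 : ∀ x ∈ Icc (0:ℝ) L, w x 0 = v x 0)
    (h1 : ∀ x ∈ Icc (0:ℝ) L, pdt w x 0 = pdt v x 0) :
    ∀ x ∈ Icc (0:ℝ) L, ∀ t ∈ Icc (0:ℝ) T, w x t = v x t := by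
  obtain ⟨w', sw, hw', ew⟩ := exists_extension hL hT hw
  obtain ⟨v', sv, hv', ev⟩ := exists_extension hL hT hv
  have t0 : (0:ℝ) ∈ Icc (0:ℝ) T := ⟨le_rfl, hT.le⟩
  have h := smooth_unique L D k2 T hL hD hk2 hT p w' v' hp sw sv hw' hv'
    (fun x hx => by rw [(ew x hx 0 t0).1, (ev x hx 0 t0).1, h0 x hx])
    (fun x hx => by rw [(ew x hx 0 t0).2, (ev x hx 0 t0).2, h1 x hx])
  intro x hx t ht
  rw [← (ew x hx t ht).1, ← (ev x hx t ht).1, h x hx t ht]
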